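/- Let f : [0,T] × ℝⁿ → ℝⁿ satisfy Assumptions (ii) and (iii), and for 1 ≤ i ≤ m let A_i ∈ ℝ^{n×n}, B_i ∈ ℝⁿ, C_i ∈ ℝ^{1×n}, D_i ∈ ℝ. If each set-valued map x ↦ {(A_i x + B_i)·σ : σ ∈ sgn(C_i x + D_i)} from ℝⁿ to ℝⁿ is hypomonotone, then for every initial condition x₀ ∈ ℝⁿ the differential inclusion ẋ(t) ∈ f(t, x(t)) - Σ_{i=1}^m (A_i x(t) + B_i)·sgn(C_i x(t) + D_i) a.e. on (0,T), x(0) = x₀, has a unique Lipschitz solution x : [0,T] → ℝⁿ. -/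

import Mathlib

open MeasureTheory Set
open scoped RealInnerProductSpace

noncomputable section

/-- The set-valued sign function: `sgn(x) = {1}` if `x > 0`, `{-1}` if `x < 0`,
and `[-1,1]` if `x = 0`. -/
def sgnSet (x : ℝ) : Set ℝ := if 0 < x then {1} else if x < 0 then {-1} else Icc (-1) 1

/-- Matrix-vector product, as a map between Euclidean spaces. -/
def mv {m n : ℕ} (M : Matrix (Fin m) (Fin n) ℝ) (x : EuclideanSpace ℝ (Fin n)) :
    EuclideanSpace ℝ (Fin m) := WithLp.toLp 2 fun i => ∑ j, M i j * x j

/-- A Lipschitz solution on `[0,T]` of the differential inclusion `ẋ(t) ∈ F(t, x(t))`,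
`x(0) = x₀`. -/
def IsLipschitzSolution {E : Type*} [NormedAddCommGroup E] [NormedSpace ℝ E]
    (F : ℝ → E → Set E) (T : ℝ) (x₀ : E) (x : ℝ → E) : Prop :=
  (∃ K : NNReal, LipschitzOnWith K x (Icc 0 T)) ∧ x 0 = x₀ ∧
    ∀ᵐ t ∂volume, t ∈ Ioo 0 T → ∃ v ∈ F t (x t), HasDerivAt x v t

/-- Assumption (ii): `f` is Lipschitz in its second argument, uniformly in `t ∈ [0,T]`. -/
def AssumptionII {E : Type*} [NormedAddCommGroup E] (T : ℝ) (f : ℝ → E → E) : Prop :=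
  ∃ L : ℝ, 0 ≤ L ∧ ∀ t ∈ Icc (0 : ℝ) T, ∀ x₁ x₂ : E, ‖f t x₁ - f t x₂‖ ≤ L * ‖x₁ - x₂‖

/-- Assumption (iii): `f(·,x)` is differentiable in `t` and `Φ(R) < ∞` for every `R ≥ 0`. -/
def AssumptionIII {E : Type*} [NormedAddCommGroup E] [NormedSpace ℝ E]
    (T : ℝ) (f : ℝ → E → E) : Prop :=
  (∀ x : E, Differentiable ℝ fun t => f t x) ∧
  ∀ R : ℝ, 0 ≤ R → ∃ M : ℝ,
    ∀ v : ℝ → E, eLpNorm v 2 (volume.restrict (Ioo 0 T)) ≤ ENNReal.ofReal R →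
      eLpNorm (fun t => deriv (fun τ => f τ (v t)) t) 2 (volume.restrict (Ioo 0 T)) ≤
        ENNReal.ofReal M

/-- A set-valued map `F : ℝⁿ ⇉ ℝⁿ` is hypomonotone if for some constant `k ≥ 0`,
`⟨u - v, x - y⟩ ≥ -k‖x - y‖²` for all selections. -/
def Hypomonotone {n : ℕ}
    (F : EuclideanSpace ℝ (Fin n) → Set (EuclideanSpace ℝ (Fin n))) : Prop :=
  ∃ k : ℝ, 0 ≤ k ∧ ∀ x y u v : EuclideanSpace ℝ (Fin n),
    u ∈ F x → v ∈ F y → -(k * ‖x - y‖ ^ 2) ≤ ⟪u - v, x - y⟫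
open Filter Topology Metric
open scoped NNReal

/-- Saturation. -/
def satFn (k : ℕ) (s : ℝ) : ℝ := max (-1) (min 1 ((k : ℝ) * s))

lemma satFn_abs_le (k : ℕ) (s : ℝ) : |satFn k s| ≤ 1 := by
  unfold satFn
  rw [abs_le]
  exact ⟨le_max_left _ _, max_le (by norm_num) (min_le_left _ _)⟩

lemma satFn_lip (k : ℕ) (s r : ℝ) : |satFn k s - satFn k r| ≤ k * |s - r| := by
  unfold satFn
  have h1 := abs_max_sub_max_le_abs (min 1 ((k : ℝ) * s)) (min 1 ((k : ℝ) * r)) (-1)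
  have h2 := abs_min_sub_min_le_max 1 ((k : ℝ) * s) 1 ((k : ℝ) * r)
  rw [max_comm (-1), max_comm (-1)]
  refine h1.trans (h2.trans ?_)
  rw [← mul_sub, abs_mul, Nat.abs_cast]
  simp
  positivity

lemma satFn_near (s₀ : ℝ) : ∃ δ > 0, ∃ N : ℕ, ∀ k ≥ N, ∀ s, |s - s₀| < δ →
    satFn k s ∈ sgnSet s₀ := by
  rcases lt_trichotomy s₀ 0 with h | h | h
  · obtain ⟨N, hN⟩ := exists_nat_ge (2 / (-s₀))
    refine ⟨-s₀ / 2, by linarith, N, fun k hk s hs => ?_⟩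
    have hk' : 2 / (-s₀) ≤ (k : ℝ) := hN.trans (by exact_mod_cast hk)
    rw [div_le_iff₀ (by linarith)] at hk'
    have := (abs_lt.1 hs).2
    have h3 : (k : ℝ) * s ≤ -1 := by
      have : (k : ℝ) * s ≤ k * (s₀ / 2) := by gcongr; linarith
      linarith
    simp only [sgnSet, h, not_lt.2 h.le, if_true, if_false, mem_singleton_iff, satFn]
    exact max_eq_left ((min_le_right _ _).trans h3)
  · refine ⟨1, one_pos, 0, fun k _ s _ => ?_⟩
    simp only [sgnSet, h, lt_irrefl, if_false]
    exact abs_le.1 (satFn_abs_le k s)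
  · obtain ⟨N, hN⟩ := exists_nat_ge (2 / s₀)
    refine ⟨s₀ / 2, by linarith, N, fun k hk s hs => ?_⟩
    have hk' : 2 / s₀ ≤ (k : ℝ) := hN.trans (by exact_mod_cast hk)
    rw [div_le_iff₀ (by linarith)] at hk'
    have := (abs_lt.1 hs).1
    have h3 : 1 ≤ (k : ℝ) * s := by
      have : (k : ℝ) * (s₀ / 2) ≤ k * s := by gcongr; linarith
      linarith
    simp only [sgnSet, h, if_true, mem_singleton_iff, satFn]
    rw [min_eq_left h3]; norm_num

lemma sgnSet_abs_le {s σ : ℝ} (h : σ ∈ sgnSet s) : |σ| ≤ 1 := by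
  unfold sgnSet at h
  split_ifs at h
  · simp_all
  · simp_all
  · exact abs_le.2 h

lemma sgnSet_convex (s : ℝ) : Convex ℝ (sgnSet s) := by
  unfold sgnSet
  split_ifs
  · exact convex_singleton _
  · exact convex_singleton _
  · exact convex_Icc _ _

lemma sgnSet_compact (s : ℝ) : IsCompact (sgnSet s) := by
  unfold sgnSet
  split_ifs
  · exact isCompact_singleton
  · exact isCompact_singleton
  · exact isCompact_Icc

/-- Coordinatewise truncation. -/
def clampE {n : ℕ} (R : ℝ) (x : EuclideanSpace ℝ (Fin n)) : EuclideanSpace ℝ (Fin n) :=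
  WithLp.toLp 2 fun i => max (-R) (min R (x i))

lemma clampE_dist {n : ℕ} (R : ℝ) (x y : EuclideanSpace ℝ (Fin n)) :
    ‖clampE R x - clampE R y‖ ≤ ‖x - y‖ := by
  rw [EuclideanSpace.norm_eq, EuclideanSpace.norm_eq]
  apply Real.sqrt_le_sqrt
  refine Finset.sum_le_sum fun i _ => ?_
  simp only [Real.norm_eq_abs]
  refine pow_le_pow_left₀ (abs_nonneg _) ?_ 2
  simp only [clampE, PiLp.sub_apply]
  have h1 := abs_max_sub_max_le_abs (min R (x i)) (min R (y i)) (-R)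
  have h2 := abs_min_sub_min_le_max R (x i) R (y i)
  rw [max_comm (-R), max_comm (-R)]
  refine h1.trans (h2.trans ?_)
  simp

lemma clampE_eq {n : ℕ} (R : ℝ) (x : EuclideanSpace ℝ (Fin n)) (h : ‖x‖ ≤ R) :
    clampE R x = x := by
  ext i
  have := (abs_le.1 ((PiLp.norm_apply_le x i).trans h))
  simp only [clampE]
  rw [min_eq_right this.2, max_eq_right this.1]

lemma clampE_norm_le {n : ℕ} (R : ℝ) (hR : 0 ≤ R) (x : EuclideanSpace ℝ (Fin n)) :
    ‖clampE R x‖ ≤ ‖x‖ := by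
  have h := clampE_dist R x 0
  rw [clampE_eq R 0 (by simpa using hR)] at h
  simpa using h

lemma clampE_norm_le' {n : ℕ} (R : ℝ) (hR : 0 ≤ R) (x : EuclideanSpace ℝ (Fin n)) :
    ‖clampE R x‖ ≤ √(n * R ^ 2) := by
  rw [EuclideanSpace.norm_eq]
  apply Real.sqrt_le_sqrt
  have : ∑ i : Fin n, R ^ 2 = n * R ^ 2 := by simp
  rw [← this]
  refine Finset.sum_le_sum fun i _ => ?_
  simp only [Real.norm_eq_abs]
  gcongr
  simp only [clampE]
  exact abs_le.2 ⟨le_max_left _ _, max_le (by linarith) (min_le_left _ _)⟩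

/-- Global existence for locally Lipschitz ODEs with linear growth. -/
lemma ode_exists {n : ℕ} {T : ℝ} (hT : 0 < T)
    (F : ℝ → EuclideanSpace ℝ (Fin n) → EuclideanSpace ℝ (Fin n))
    (hc : ∀ x, ContinuousOn (fun t => F t x) (Icc 0 T))
    (hl : ∀ R : ℝ, ∃ K : ℝ≥0, ∀ t ∈ Icc (0 : ℝ) T, LipschitzOnWith K (F t) (closedBall 0 R))
    (α β : ℝ) (hα : 0 ≤ α) (hβ : 0 ≤ β)
    (hg : ∀ t ∈ Icc (0 : ℝ) T, ∀ x, ‖F t x‖ ≤ α + β * ‖x‖)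
    (x₀ : EuclideanSpace ℝ (Fin n)) :
    ∃ x : ℝ → EuclideanSpace ℝ (Fin n), x 0 = x₀ ∧
      (∀ t ∈ Icc (0 : ℝ) T, HasDerivWithinAt x (F t (x t)) (Icc 0 T) t) ∧
      (∀ t ∈ Icc (0 : ℝ) T, ‖x t‖ ≤ gronwallBound ‖x₀‖ β α T) ∧
      ContinuousOn (fun t => F t (x t)) (Icc 0 T) := by
  set R := gronwallBound ‖x₀‖ β α T with hRdef
  have hR : 0 ≤ R := by
    have := gronwallBound_mono (norm_nonneg x₀) hα hβ hT.le
    rw [gronwallBound_x0] at this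
    exact (norm_nonneg _).trans this
  set R' := √(n * R ^ 2)
  obtain ⟨K, hK⟩ := hl R'
  set M : ℝ≥0 := ⟨α + β * R', by positivity⟩
  have hcl : ∀ x : EuclideanSpace ℝ (Fin n), clampE R x ∈ closedBall 0 R' := fun x => by
    rw [mem_closedBall_zero_iff]; exact clampE_norm_le' R hR x
  have hPL : IsPicardLindelof (fun t x => F t (clampE R x)) (tmin := 0) (tmax := T)
      ⟨0, by simp [hT.le]⟩ x₀ (M * ⟨T, hT.le⟩) 0 M K := by
    refine ⟨fun t ht => ?_, fun x _ => hc _, fun t ht x _ => ?_, ?_⟩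
    · apply LipschitzOnWith.of_dist_le_mul
      intro x _ y _
      refine ((hK t ht).dist_le_mul _ (hcl x) _ (hcl y)).trans ?_
      gcongr
      rw [dist_eq_norm, dist_eq_norm]
      exact clampE_dist R x y
    · refine (hg t ht _).trans ?_
      change _ ≤ α + β * R'
      gcongr
      exact clampE_norm_le' R hR x
    · simp only [sub_zero, NNReal.coe_zero]
      rw [max_eq_left hT.le]; rfl
  obtain ⟨x, hx0, hx⟩ := hPL.exists_eq_forall_mem_Icc_hasDerivWithinAt₀
  simp only at hx0 hx
  have hxc : ContinuousOn x (Icc 0 T) := fun t ht => (hx t ht).continuousWithinAt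
  have hb : ∀ t ∈ Icc (0 : ℝ) T, ‖x t‖ ≤ R := by
    intro t ht
    have := norm_le_gronwallBound_of_norm_deriv_right_le (δ := ‖x₀‖) (K := β) (ε := α) hxc
      (f' := fun t => F t (clampE R (x t)))
      (fun s hs => (hx s ⟨hs.1, hs.2.le⟩).mono_of_mem_nhdsWithin (Icc_mem_nhdsGE_of_mem hs))
      (by rw [hx0]) (fun s hs => by
        have h1 := hg s ⟨hs.1, hs.2.le⟩ (clampE R (x s))
        have h2 := mul_le_mul_of_nonneg_left (clampE_norm_le R hR (x s)) hβ
        linarith) t ht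
    refine this.trans ?_
    apply gronwallBound_mono (norm_nonneg x₀) hα hβ
    simpa using ht.2
  have hxx : ∀ t ∈ Icc (0 : ℝ) T, clampE R (x t) = x t := fun t ht => clampE_eq R _ (hb t ht)
  refine ⟨x, hx0, fun t ht => ?_, hb, ?_⟩
  · have := hx t ht
    rwa [hxx t ht] at this
  · obtain ⟨K', hK'⟩ := hl R
    have hcu : ContinuousOn (fun p : ℝ × EuclideanSpace ℝ (Fin n) => F p.1 p.2)
        ((Icc 0 T) ×ˢ (closedBall 0 R)) :=
      continuousOn_prod_of_continuousOn_lipschitzOnWith' _ K' hK' (fun y _ => hc y)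
    exact hcu.comp (f := fun t => (t, x t)) (continuousOn_id.prodMk hxc)
      (fun t ht => ⟨ht, by simpa using hb t ht⟩)

/-- Limits of approximate solutions. -/
lemma limit_solution {E : Type*} [NormedAddCommGroup E] [NormedSpace ℝ E] [FiniteDimensional ℝ E]
    {T : ℝ} (hT : 0 < T) (F : ℕ → ℝ → E → E) (x : ℕ → ℝ → E) (x₀ : E) (R : ℝ) (K : ℝ≥0)
    (h0 : ∀ k, x k 0 = x₀)
    (hd : ∀ k, ∀ t ∈ Icc (0 : ℝ) T, HasDerivWithinAt (x k) (F k t (x k t)) (Icc 0 T) t)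
    (hb : ∀ k, ∀ t ∈ Icc (0 : ℝ) T, ‖x k t‖ ≤ R)
    (hc : ∀ k, ContinuousOn (fun t => F k t (x k t)) (Icc 0 T))
    (hlip : ∀ k, LipschitzOnWith K (x k) (Icc 0 T))
    (Φ : ℝ → E → Set E) (hconv : ∀ t ξ, Convex ℝ (Φ t ξ)) (hclosed : ∀ t ξ, IsClosed (Φ t ξ))
    (hΦ : ∀ t ∈ Ioo (0 : ℝ) T, ∀ ξ, ∀ ε > 0, ∃ δ > 0, ∃ N : ℕ, ∀ k ≥ N, ∀ s ∈ Ioo (0 : ℝ) T,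
      |s - t| < δ → ∀ y, ‖y - ξ‖ < δ → F k s y ∈ cthickening ε (Φ t ξ)) :
    ∃ z : ℝ → E, IsLipschitzSolution Φ T x₀ z := by
  have : ProperSpace E := FiniteDimensional.proper ℝ E
  let U : Ultrafilter ℕ := hyperfilter ℕ
  have hU : (U : Filter ℕ) ≤ atTop := by
    rw [← Nat.cofinite_eq_atTop]; exact hyperfilter_le_cofinite
  have hex : ∀ t, ∃ z, t ∈ Icc (0 : ℝ) T → Tendsto (fun k => x k t) U (𝓝 z) := by
    intro t
    by_cases ht : t ∈ Icc (0 : ℝ) T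
    · obtain ⟨z, _, hz⟩ := (isCompact_closedBall (0 : E) R).ultrafilter_le_nhds'
        (U.map (fun k => x k t)) (by
          rw [Ultrafilter.mem_map]
          exact Filter.mem_of_superset Filter.univ_mem
            (fun k _ => by simpa using hb k t ht))
      exact ⟨z, fun _ => hz⟩
    · exact ⟨0, fun h => absurd h ht⟩
  choose z hz using hex
  have hzlip : LipschitzOnWith K z (Icc 0 T) := by
    apply LipschitzOnWith.of_dist_le_mul
    intro s hs t ht
    exact le_of_tendsto ((hz s hs).dist (hz t ht))
      (Eventually.of_forall fun k => (hlip k).dist_le_mul s hs t ht)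
  refine ⟨z, ⟨K, hzlip⟩, ?_, ?_⟩
  · have h1 := hz 0 ⟨le_rfl, hT.le⟩
    simp only [h0] at h1
    exact (tendsto_nhds_unique h1 tendsto_const_nhds)
  · have hae := hzlip.ae_differentiableWithinAt_real measurableSet_Icc
    rw [ae_restrict_iff' measurableSet_Icc] at hae
    filter_upwards [hae] with t ht htT
    have hder : HasDerivAt z (deriv z t) t :=
      ((ht (Ioo_subset_Icc_self htT)).differentiableAt (Icc_mem_nhds htT.1 htT.2)).hasDerivAt
    refine ⟨deriv z t, ?_, hder⟩
    rw [← (hclosed t (z t)).closure_eq, closure_eq_iInter_cthickening]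
    refine mem_iInter₂.2 fun ε hε => ?_
    obtain ⟨δ, hδ, N, hN⟩ := hΦ t htT (z t) ε hε
    have hslope : Tendsto (fun h => h⁻¹ • (z (t + h) - z t)) (𝓝[>] 0) (𝓝 (deriv z t)) :=
      hder.tendsto_slope_zero_right
    refine isClosed_cthickening.mem_of_tendsto hslope ?_
    set η := min (T - t) (min δ (δ / (2 * (K + 1)))) with hη
    have hηpos : 0 < η := by
      have := htT.2
      have h2 : 0 < δ / (2 * ((K : ℝ) + 1)) := by positivity
      simp only [hη, lt_min_iff]
      exact ⟨by linarith, hδ, h2⟩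
    filter_upwards [Ioo_mem_nhdsGT hηpos] with h hh
    have hh1 : h < T - t := hh.2.trans_le (min_le_left _ _)
    have hh2 : h < δ := hh.2.trans_le ((min_le_right _ _).trans (min_le_left _ _))
    have hh3 : h < δ / (2 * (K + 1)) := hh.2.trans_le ((min_le_right _ _).trans (min_le_right _ _))
    have hsub : Icc t (t + h) ⊆ Ioo 0 T := fun s hs =>
      ⟨htT.1.trans_le hs.1, hs.2.trans_lt (by linarith)⟩
    have htI := Ioo_subset_Icc_self htT
    have hthI : t + h ∈ Icc 0 T := Ioo_subset_Icc_self (hsub ⟨by linarith [hh.1], le_rfl⟩)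
    have hlim : Tendsto (fun k => h⁻¹ • (x k (t + h) - x k t)) U
        (𝓝 (h⁻¹ • (z (t + h) - z t))) := ((hz _ hthI).sub (hz _ htI)).const_smul _
    refine isClosed_cthickening.mem_of_tendsto hlim ?_
    have he1 : ∀ᶠ k in (U : Filter ℕ), dist (x k t) (z t) < δ / 2 :=
      (Metric.tendsto_nhds.1 (hz t htI)) _ (by positivity)
    have he2 : ∀ᶠ k in (U : Filter ℕ), N ≤ k := hU (eventually_ge_atTop N)
    filter_upwards [he1, he2] with k hk1 hk2
    have hle : t ≤ t + h := by linarith [hh.1]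
    have hint : ∀ s ∈ Icc t (t + h), F k s (x k s) ∈ cthickening ε (Φ t (z t)) := by
      intro s hs
      have hst : |s - t| ≤ h := by rw [abs_of_nonneg (by linarith [hs.1])]; linarith [hs.2]
      refine hN k hk2 s (hsub hs) (by linarith) _ ?_
      have h1 := (hlip k).dist_le_mul s (Ioo_subset_Icc_self (hsub hs)) t htI
      rw [Real.dist_eq] at h1
      have h2 : (K : ℝ) * |s - t| ≤ K * h := by gcongr
      have h3 : (K : ℝ) * h ≤ δ / 2 := by
        rw [lt_div_iff₀ (by positivity)] at hh3
        nlinarith [hh.1]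
      have h4 := dist_triangle (x k s) (x k t) (z t)
      rw [← dist_eq_norm]
      linarith
    have hcont : ContinuousOn (fun s => F k s (x k s)) (Icc t (t + h)) :=
      (hc k).mono (hsub.trans Ioo_subset_Icc_self)
    have hFTC : ∫ s in t..(t + h), F k s (x k s) = x k (t + h) - x k t := by
      apply intervalIntegral.integral_eq_sub_of_hasDerivAt
      · intro s hs
        rw [uIcc_of_le hle] at hs
        have := hsub hs
        exact (hd k s (Ioo_subset_Icc_self this)).hasDerivAt (Icc_mem_nhds this.1 this.2)
      · apply ContinuousOn.intervalIntegrable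
        rwa [uIcc_of_le hle]
    have havg := ((hconv t (z t)).cthickening ε).set_average_mem (μ := volume)
      (t := Ioc t (t + h)) (f := fun s => F k s (x k s)) isClosed_cthickening
      (by simp [hh.1]) (by simp)
      ((ae_restrict_iff' measurableSet_Ioc).2 (Eventually.of_forall
        fun s hs => hint s (Ioc_subset_Icc_self hs)))
      ((hcont.integrableOn_Icc).mono_set Ioc_subset_Icc_self)
    rw [setAverage_eq, ← intervalIntegral.integral_of_le hle, hFTC] at havg
    simpa [hh.1.le] using havg

/-- Uniqueness under a one-sided Lipschitz condition. -/
lemma uniq_solution {E : Type*} [NormedAddCommGroup E] [InnerProductSpace ℝ E]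
    {T : ℝ} (Φ : ℝ → E → Set E) (C : ℝ) (x₀ : E)
    (hC : ∀ t ∈ Ioo (0 : ℝ) T, ∀ x y u v, u ∈ Φ t x → v ∈ Φ t y →
      ⟪u - v, x - y⟫ ≤ C * ‖x - y‖ ^ 2)
    (x y : ℝ → E) (hx : IsLipschitzSolution Φ T x₀ x) (hy : IsLipschitzSolution Φ T x₀ y) :
    ∀ t ∈ Icc (0 : ℝ) T, y t = x t := by
  obtain ⟨⟨K₁, hx1⟩, hx0, hxd⟩ := hx
  obtain ⟨⟨K₂, hy1⟩, hy0, hyd⟩ := hy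
  intro t ht
  set g : ℝ → ℝ := fun s => Real.exp (-(2 * C) * s) * (‖x s - y s‖ * ‖x s - y s‖) with hg
  have hI : uIcc 0 t ⊆ Icc 0 T := by
    rw [uIcc_of_le ht.1]; exact Icc_subset_Icc_right ht.2
  have hn : LipschitzOnWith (K₁ + K₂) (fun s => ‖x s - y s‖) (uIcc 0 t) := by
    apply LipschitzOnWith.of_dist_le_mul
    intro s hs r hr
    have h1 := hx1.dist_le_mul s (hI hs) r (hI hr)
    have h2 := hy1.dist_le_mul s (hI hs) r (hI hr)
    rw [dist_eq_norm (x s)] at h1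
    rw [dist_eq_norm (y s)] at h2
    rw [Real.dist_eq]
    have h3 := abs_norm_sub_norm_le (x s - y s) (x r - y r)
    have h4 : x s - y s - (x r - y r) = (x s - x r) - (y s - y r) := by abel
    rw [h4] at h3
    have h5 := norm_sub_le (x s - x r) (y s - y r)
    push_cast
    linarith
  have hac := hn.absolutelyContinuousOnInterval
  have hexp : AbsolutelyContinuousOnInterval (fun s => Real.exp (-(2 * C) * s)) 0 t := by
    apply ContDiffOn.absolutelyContinuousOnInterval
    fun_prop
  have hgac : AbsolutelyContinuousOnInterval g 0 t := hexp.fun_mul (hac.fun_mul hac)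
  have hFTC := hgac.integral_deriv_eq_sub
  have hle : ∫ s in (0 : ℝ)..t, deriv g s ≤ 0 := by
    rw [intervalIntegral.integral_of_le ht.1, integral_Ioc_eq_integral_Ioo]
    apply integral_nonpos_of_ae
    rw [Filter.EventuallyLE, ae_restrict_iff' measurableSet_Ioo]
    filter_upwards [hxd, hyd] with s hsx hsy hs
    have hsT : s ∈ Ioo 0 T := ⟨hs.1, hs.2.trans_le ht.2⟩
    obtain ⟨u, hu, hu'⟩ := hsx hsT
    obtain ⟨v, hv, hv'⟩ := hsy hsT
    have h1 : HasDerivAt (fun s => ‖x s - y s‖ * ‖x s - y s‖) (2 * ⟪x s - y s, u - v⟫) s := by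
      have := (hu'.sub hv').norm_sq
      simpa [sq] using this
    have h2 : HasDerivAt (fun s => Real.exp (-(2 * C) * s))
        (Real.exp (-(2 * C) * s) * (-(2 * C))) s := by
      have := ((hasDerivAt_id s).const_mul (-(2 * C))).exp
      simpa using this
    have h3 := h2.mul h1
    have h4 : deriv g s = _ := h3.deriv
    rw [h4]
    have h5 := hC s hsT _ _ _ _ hu hv
    rw [real_inner_comm] at h5
    have h6 := Real.exp_pos (-(2 * C) * s)
    simp only [Pi.zero_apply]
    nlinarith
  have hg0 : g 0 = 0 := by simp [hg, hx0, hy0]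
  rw [hFTC, hg0, sub_zero] at hle
  have h6 := Real.exp_pos (-(2 * C) * t)
  have h7 : ‖x t - y t‖ * ‖x t - y t‖ ≤ 0 := by
    by_contra hcon
    exact absurd hle (not_le.2 (mul_pos h6 (not_le.1 hcon)))
  have h8 : ‖x t - y t‖ = 0 := by nlinarith [norm_nonneg (x t - y t)]
  exact (sub_eq_zero.1 (norm_eq_zero.1 h8)).symm

lemma mv_lip {m n : ℕ} (M : Matrix (Fin m) (Fin n) ℝ) :
    ∃ C : ℝ, 0 ≤ C ∧ ∀ x y, ‖mv M x - mv M y‖ ≤ C * ‖x - y‖ := by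
  let l : EuclideanSpace ℝ (Fin n) →ₗ[ℝ] EuclideanSpace ℝ (Fin m) :=
    { toFun := mv M
      map_add' := fun x y => by
        ext i; simp [mv, mul_add, Finset.sum_add_distrib]
      map_smul' := fun a x => by
        ext i; simp [mv, Finset.mul_sum, mul_left_comm] }
  refine ⟨‖LinearMap.toContinuousLinearMap l‖, norm_nonneg _, fun x y => ?_⟩
  have := (LinearMap.toContinuousLinearMap l).le_opNorm (x - y)
  rw [map_sub] at this
  exact this

lemma exists_pos_le_all {ι : Type*} [Finite ι] (δ : ι → ℝ) (h : ∀ i, 0 < δ i) :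
    ∃ d > 0, ∀ i, d < δ i := by
  have h1 : ∀ᶠ d in 𝓝[>] (0 : ℝ), ∀ i, d < δ i :=
    eventually_all.2 fun i => Filter.mem_of_superset (Ioo_mem_nhdsGT (h i)) fun _ hd => hd.2
  obtain ⟨d, hd, hd'⟩ := (h1.and self_mem_nhdsWithin).exists
  exact ⟨d, hd', hd⟩

/-- Existence, abstract version. -/
lemma exists_solution (n m : ℕ) (T : ℝ) (hT : 0 < T)
    (f : ℝ → EuclideanSpace ℝ (Fin n) → EuclideanSpace ℝ (Fin n))
    (L : ℝ) (hL : 0 ≤ L)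
    (hfL : ∀ t ∈ Icc (0 : ℝ) T, ∀ x₁ x₂, ‖f t x₁ - f t x₂‖ ≤ L * ‖x₁ - x₂‖)
    (hfc : ∀ x, Continuous fun t => f t x)
    (a : Fin m → EuclideanSpace ℝ (Fin n) → EuclideanSpace ℝ (Fin n))
    (La : ℝ) (hLa : 0 ≤ La) (ha : ∀ i x y, ‖a i x - a i y‖ ≤ La * ‖x - y‖)
    (c : Fin m → EuclideanSpace ℝ (Fin n)) (D : Fin m → ℝ)
    (x₀ : EuclideanSpace ℝ (Fin n)) :
    ∃ x : ℝ → EuclideanSpace ℝ (Fin n),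
      IsLipschitzSolution
        (fun t ξ => {v | ∃ σ : Fin m → ℝ,
          (∀ i, σ i ∈ sgnSet (⟪c i, ξ⟫ + D i)) ∧
          v = f t ξ - ∑ i, σ i • a i ξ}) T x₀ x := by
  obtain ⟨M₀, hM₀⟩ := isCompact_Icc.exists_bound_of_continuousOn
    (s := Icc (0 : ℝ) T) (hfc 0).continuousOn
  have hM₀' : 0 ≤ M₀ := (norm_nonneg _).trans (hM₀ 0 ⟨le_rfl, hT.le⟩)
  have hfg : ∀ t ∈ Icc (0 : ℝ) T, ∀ ξ, ‖f t ξ‖ ≤ M₀ + L * ‖ξ‖ := by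
    intro t ht ξ
    have h1 := hfL t ht ξ 0
    have h2 := norm_le_norm_add_norm_sub' (f t ξ) (f t 0)
    rw [sub_zero] at h1
    linarith [hM₀ t ht]
  have hag : ∀ i ξ, ‖a i ξ‖ ≤ ‖a i 0‖ + La * ‖ξ‖ := by
    intro i ξ
    have h1 := ha i ξ 0
    have h2 := norm_le_norm_add_norm_sub' (a i ξ) (a i 0)
    rw [sub_zero] at h1
    linarith
  have hgl : ∀ i ξ ζ, |(⟪c i, ξ⟫ + D i) - (⟪c i, ζ⟫ + D i)| ≤ ‖c i‖ * ‖ξ - ζ‖ := by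
    intro i ξ ζ
    rw [add_sub_add_right_eq_sub, ← inner_sub_right]
    exact abs_real_inner_le_norm _ _
  set F : ℕ → ℝ → EuclideanSpace ℝ (Fin n) → EuclideanSpace ℝ (Fin n) := fun k t ξ =>
    f t ξ - ∑ i, satFn k (⟪c i, ξ⟫ + D i) • a i ξ with hF
  set α := M₀ + ∑ i, ‖a i 0‖ with hα
  set β := L + m * La with hβ
  have hα0 : 0 ≤ α := add_nonneg hM₀' (Finset.sum_nonneg fun i _ => norm_nonneg _)
  have hβ0 : 0 ≤ β := by positivity
  have hFg : ∀ k, ∀ t ∈ Icc (0 : ℝ) T, ∀ ξ, ‖F k t ξ‖ ≤ α + β * ‖ξ‖ := by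
    intro k t ht ξ
    have h1 : ‖∑ i, satFn k (⟪c i, ξ⟫ + D i) • a i ξ‖ ≤ ∑ i, (‖a i 0‖ + La * ‖ξ‖) := by
      refine norm_sum_le_of_le _ fun i _ => ?_
      rw [norm_smul, Real.norm_eq_abs]
      have h2 := satFn_abs_le k (⟪c i, ξ⟫ + D i)
      have h3 := mul_le_mul_of_nonneg_right h2 (norm_nonneg (a i ξ))
      linarith [hag i ξ]
    rw [Finset.sum_add_distrib] at h1
    simp only [Finset.sum_const, Finset.card_univ, Fintype.card_fin, nsmul_eq_mul] at h1
    have h2 := norm_sub_le (f t ξ) (∑ i, satFn k (⟪c i, ξ⟫ + D i) • a i ξ)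
    have h3 := hfg t ht ξ
    rw [hα, hβ]
    simp only [hF]
    nlinarith
  have hFl : ∀ k, ∀ R : ℝ, ∃ K : ℝ≥0, ∀ t ∈ Icc (0 : ℝ) T,
      LipschitzOnWith K (F k t) (closedBall 0 R) := by
    intro k R
    refine ⟨Real.toNNReal (L + ∑ i, (k * ‖c i‖ * (‖a i 0‖ + La * R) + La)), fun t ht => ?_⟩
    apply LipschitzOnWith.of_dist_le_mul
    intro ξ hξ ζ _
    rw [mem_closedBall_zero_iff] at hξ
    rw [dist_eq_norm, dist_eq_norm]
    have h1 : ‖(∑ i, satFn k (⟪c i, ξ⟫ + D i) • a i ξ) - ∑ i, satFn k (⟪c i, ζ⟫ + D i) • a i ζ‖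
        ≤ ∑ i, (k * ‖c i‖ * (‖a i 0‖ + La * R) + La) * ‖ξ - ζ‖ := by
      rw [← Finset.sum_sub_distrib]
      refine norm_sum_le_of_le _ fun i _ => ?_
      set p := satFn k (⟪c i, ξ⟫ + D i)
      set q := satFn k (⟪c i, ζ⟫ + D i)
      have e : p • a i ξ - q • a i ζ = (p - q) • a i ξ + q • (a i ξ - a i ζ) := by module
      rw [e]
      refine (norm_add_le _ _).trans ?_
      rw [norm_smul, norm_smul, Real.norm_eq_abs, Real.norm_eq_abs, add_mul]
      have hpq : |p - q| ≤ k * (‖c i‖ * ‖ξ - ζ‖) :=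
        (satFn_lip k _ _).trans (mul_le_mul_of_nonneg_left (hgl i ξ ζ) (Nat.cast_nonneg k))
      have ha1 : ‖a i ξ‖ ≤ ‖a i 0‖ + La * R :=
        (hag i ξ).trans (by gcongr)
      have hq : |q| ≤ 1 := satFn_abs_le _ _
      have t1 : |p - q| * ‖a i ξ‖ ≤ k * (‖c i‖ * ‖ξ - ζ‖) * (‖a i 0‖ + La * R) := by
        gcongr
      have t2 : |q| * ‖a i ξ - a i ζ‖ ≤ 1 * (La * ‖ξ - ζ‖) := by
        gcongr
        exact ha i ξ ζ
      linarith
    rw [← Finset.sum_mul] at h1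
    have h2 := hfL t ht ξ ζ
    have e : F k t ξ - F k t ζ = (f t ξ - f t ζ) - ((∑ i, satFn k (⟪c i, ξ⟫ + D i) • a i ξ) -
        ∑ i, satFn k (⟪c i, ζ⟫ + D i) • a i ζ) := by
      simp only [hF]; abel
    rw [e]
    refine (norm_sub_le _ _).trans ?_
    refine le_trans ?_ (mul_le_mul_of_nonneg_right (Real.le_coe_toNNReal _) (norm_nonneg _))
    linarith
  have hFc : ∀ k ξ, ContinuousOn (fun t => F k t ξ) (Icc 0 T) := fun k ξ =>
    ((hfc ξ).sub continuous_const).continuousOn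
  choose x hx0 hxd hxb hxc using fun k =>
    ode_exists hT (F k) (hFc k) (hFl k) α β hα0 hβ0 (hFg k) x₀
  set R := gronwallBound ‖x₀‖ β α T
  have hlip : ∀ k, LipschitzOnWith (Real.toNNReal (α + β * R)) (x k) (Icc 0 T) := by
    intro k
    refine (convex_Icc 0 T).lipschitzOnWith_of_nnnorm_hasDerivWithin_le (hxd k) fun t ht => ?_
    rw [← NNReal.coe_le_coe, coe_nnnorm]
    refine le_trans ?_ (Real.le_coe_toNNReal _)
    refine (hFg k t ht _).trans ?_
    have := mul_le_mul_of_nonneg_left (hxb k t ht) hβ0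
    linarith
  apply limit_solution hT F x x₀ R _ hx0 hxd hxb hxc hlip
  · rintro t ξ _ ⟨σ, hσ, rfl⟩ _ ⟨τ, hτ, rfl⟩ p q hp hq hpq
    refine ⟨fun i => p * σ i + q * τ i, fun i => sgnSet_convex _ (hσ i) (hτ i) hp hq hpq, ?_⟩
    simp only [add_smul, Finset.sum_add_distrib, smul_sub, Finset.smul_sum, mul_smul]
    have : f t ξ = p • f t ξ + q • f t ξ := by rw [← add_smul, hpq, one_smul]
    nth_rewrite 3 [this]
    abel
  · intro t ξ
    have hcp : IsCompact (Set.pi univ fun i => sgnSet (⟪c i, ξ⟫ + D i)) :=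
      isCompact_univ_pi fun i => sgnSet_compact _
    have hcont : Continuous fun σ : Fin m → ℝ => f t ξ - ∑ i, σ i • a i ξ := by fun_prop
    have heq : {v | ∃ σ : Fin m → ℝ, (∀ i, σ i ∈ sgnSet (⟪c i, ξ⟫ + D i)) ∧
        v = f t ξ - ∑ i, σ i • a i ξ} = (fun σ : Fin m → ℝ => f t ξ - ∑ i, σ i • a i ξ) ''
          (Set.pi univ fun i => sgnSet (⟪c i, ξ⟫ + D i)) := by
      apply Set.ext
      intro v
      constructor
      · rintro ⟨σ, hσ, rfl⟩
        exact ⟨σ, fun i _ => hσ i, rfl⟩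
      · rintro ⟨σ, hσ, rfl⟩
        exact ⟨σ, fun i => hσ i trivial, rfl⟩
    exact heq ▸ (hcp.image hcont).isClosed
  · intro t ht ξ ε hε
    choose δ hδ N hN using fun i => satFn_near (⟪c i, ξ⟫ + D i)
    obtain ⟨d₁, hd₁, hd₁'⟩ := exists_pos_le_all (fun i => δ i / (‖c i‖ + 1))
      (fun i => div_pos (hδ i) (by positivity))
    obtain ⟨d₂, hd₂, hd₂'⟩ := Metric.continuous_iff.1 (hfc ξ) t (ε / 2) (by positivity)
    set d₃ := ε / (2 * (β + 1)) with hd₃def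
    have hd₃ : 0 < d₃ := by positivity
    refine ⟨min d₁ (min d₂ d₃), by simp [hd₁, hd₂, hd₃], Finset.univ.sup N, ?_⟩
    intro k hk s hs hst y hy
    simp only [lt_min_iff] at hst hy
    have hsg : ∀ i, satFn k (⟪c i, y⟫ + D i) ∈ sgnSet (⟪c i, ξ⟫ + D i) := by
      intro i
      refine hN i k ((Finset.le_sup (Finset.mem_univ i)).trans hk) _ ((hgl i y ξ).trans_lt ?_)
      have h1 := hy.1.trans (hd₁' i)
      rw [lt_div_iff₀ (by positivity)] at h1
      nlinarith [norm_nonneg (y - ξ)]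
    refine mem_cthickening_of_dist_le _ _ _ _ ⟨_, hsg, rfl⟩ ?_
    rw [dist_eq_norm]
    have e : F k s y - (f t ξ - ∑ i, satFn k (⟪c i, y⟫ + D i) • a i ξ) =
        (f s y - f s ξ) + (f s ξ - f t ξ) - ∑ i, satFn k (⟪c i, y⟫ + D i) • (a i y - a i ξ) := by
      simp only [hF, smul_sub, Finset.sum_sub_distrib]; abel
    rw [e]
    have h1 := hfL s (Ioo_subset_Icc_self hs) y ξ
    have h2 := hd₂' s hst.2.1
    rw [dist_eq_norm] at h2
    have h3 : ‖∑ i, satFn k (⟪c i, y⟫ + D i) • (a i y - a i ξ)‖ ≤ ∑ i : Fin m, La * ‖y - ξ‖ := by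
      refine norm_sum_le_of_le _ fun i _ => ?_
      rw [norm_smul, Real.norm_eq_abs]
      have h2 := satFn_abs_le k (⟪c i, y⟫ + D i)
      have h3 := mul_le_mul_of_nonneg_right h2 (norm_nonneg (a i y - a i ξ))
      linarith [ha i y ξ]
    simp only [Finset.sum_const, Finset.card_univ, Fintype.card_fin, nsmul_eq_mul] at h3
    have h4 : β * ‖y - ξ‖ ≤ ε / 2 := by
      have h5 := hy.2.2.le
      rw [hd₃def, le_div_iff₀ (by positivity)] at h5
      nlinarith [norm_nonneg (y - ξ)]
    have h6 := norm_sub_le ((f s y - f s ξ) + (f s ξ - f t ξ))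
      (∑ i, satFn k (⟪c i, y⟫ + D i) • (a i y - a i ξ))
    have h7 := norm_add_le (f s y - f s ξ) (f s ξ - f t ξ)
    rw [hβ] at h4
    linarith

/-- Well-posedness of `ẋ(t) ∈ f(t,x(t)) - Σᵢ (Aᵢx(t) + Bᵢ)·sgn(Cᵢx(t) + Dᵢ)`: if each
set-valued map `x ↦ (Aᵢx + Bᵢ)·sgn(Cᵢx + Dᵢ)` is hypomonotone and `f` satisfies
Assumptions (ii)-(iii), then there is a unique Lipschitz solution on `[0,T]` for every
initial condition. (The row `Cᵢ ∈ ℝ^{1×n}` is represented by the vector `c i`.) -/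
theorem hypomonotone_affine_sgn_inclusion_existsUnique_lipschitzSolution
    (n m : ℕ) (T : ℝ) (hT : 0 < T)
    (f : ℝ → EuclideanSpace ℝ (Fin n) → EuclideanSpace ℝ (Fin n))
    (hfII : AssumptionII T f) (hfIII : AssumptionIII T f)
    (A : Fin m → Matrix (Fin n) (Fin n) ℝ) (B : Fin m → EuclideanSpace ℝ (Fin n))
    (c : Fin m → EuclideanSpace ℝ (Fin n)) (D : Fin m → ℝ)
    (hHypo : ∀ i : Fin m, Hypomonotone
      (fun ξ => {w | ∃ σ ∈ sgnSet (⟪c i, ξ⟫ + D i), w = σ • (mv (A i) ξ + B i)}))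
    (x₀ : EuclideanSpace ℝ (Fin n)) :
    ∃ x : ℝ → EuclideanSpace ℝ (Fin n),
      IsLipschitzSolution
        (fun t ξ => {v | ∃ σ : Fin m → ℝ,
          (∀ i, σ i ∈ sgnSet (⟪c i, ξ⟫ + D i)) ∧
          v = f t ξ - ∑ i, σ i • (mv (A i) ξ + B i)}) T x₀ x ∧
      ∀ y : ℝ → EuclideanSpace ℝ (Fin n),
        IsLipschitzSolution
          (fun t ξ => {v | ∃ σ : Fin m → ℝ,
            (∀ i, σ i ∈ sgnSet (⟪c i, ξ⟫ + D i)) ∧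
            v = f t ξ - ∑ i, σ i • (mv (A i) ξ + B i)}) T x₀ y →
        ∀ t ∈ Icc (0 : ℝ) T, y t = x t := by
  obtain ⟨L, hL, hfL⟩ := hfII
  choose Cm hCm hCm' using fun i => mv_lip (A i)
  choose κ hκ hκ' using hHypo
  obtain ⟨x, hx⟩ := exists_solution n m T hT f L hL hfL (fun ξ => (hfIII.1 ξ).continuous)
    (fun i ξ => mv (A i) ξ + B i) (∑ i, Cm i) (Finset.sum_nonneg fun i _ => hCm i)
    (fun i ξ ζ => by
      rw [add_sub_add_right_eq_sub]
      refine (hCm' i ξ ζ).trans ?_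
      gcongr
      exact Finset.single_le_sum (fun j _ => hCm j) (Finset.mem_univ i)) c D x₀
  refine ⟨x, hx, fun y hy => ?_⟩
  refine uniq_solution _ (L + ∑ i, κ i) x₀ ?_ x y hx hy
  rintro t ht ξ ζ _ _ ⟨σ, hσ, rfl⟩ ⟨τ, hτ, rfl⟩
  have e : f t ξ - ∑ i, σ i • (mv (A i) ξ + B i) - (f t ζ - ∑ i, τ i • (mv (A i) ζ + B i)) =
      (f t ξ - f t ζ) - ∑ i, (σ i • (mv (A i) ξ + B i) - τ i • (mv (A i) ζ + B i)) := by
    rw [Finset.sum_sub_distrib]; abel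
  rw [e, inner_sub_left, sum_inner]
  have h1 := (real_inner_le_norm (f t ξ - f t ζ) (ξ - ζ)).trans
    (mul_le_mul_of_nonneg_right (hfL t (Ioo_subset_Icc_self ht) ξ ζ) (norm_nonneg _))
  have h2 : ∑ i, -(κ i * ‖ξ - ζ‖ ^ 2) ≤
      ∑ i, ⟪σ i • (mv (A i) ξ + B i) - τ i • (mv (A i) ζ + B i), ξ - ζ⟫ :=
    Finset.sum_le_sum fun i _ => hκ' i ξ ζ _ _ ⟨σ i, hσ i, rfl⟩ ⟨τ i, hτ i, rfl⟩
  rw [Finset.sum_neg_distrib, ← Finset.sum_mul] at h2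
  nlinarith
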